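/- arXiv:2403.19860 — 3 statements merged into one kernel-verified Lean document; each statement's English description precedes it below -/
import Mathlib

section
/- Let μ and ν be probability measures on ℝ. Then there exists a unique probability measure ρ on ℝ (called the geometric mean μ♭ν of μ and ν) such that G_ρ(z)² = G_μ(z)·G_ν(z) for every z in the upper half-plane ℂ₊. (Equivalently, G_ρ(z) = −√(G_μ(z)G_ν(z)), where √ is the branch of the square root mapping ℂ∖[0,∞) into ℂ₊; note that for any probability measure ρ one has Im G_ρ(z) < 0 for z ∈ ℂ₊, so the squared equation determines ρ uniquely.) -/
open MeasureTheory Complex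

/-- The Cauchy transform of a measure on ℝ. -/
noncomputable def cauchy (μ : Measure ℝ) (z : ℂ) : ℂ := ∫ t, (z - (t : ℂ))⁻¹ ∂μ

open Filter Topology

/-- Poisson kernel. -/
noncomputable def pk (z : ℂ) (t : ℝ) : ℝ := z.im / ((t - z.re) ^ 2 + z.im ^ 2)

lemma pk_pos {z : ℂ} (hz : 0 < z.im) (t : ℝ) : 0 < pk z t := by
  unfold pk; positivity

lemma pk_cont {z : ℂ} (hz : 0 < z.im) : Continuous (pk z) := by
  unfold pk
  refine Continuous.div (by fun_prop) (by fun_prop) (fun t => ?_)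
  positivity

lemma pk_le {z : ℂ} (hz : 0 < z.im) (t : ℝ) : pk z t ≤ z.im⁻¹ := by
  unfold pk
  rw [div_le_iff₀ (by positivity)]
  have : z.im⁻¹ * z.im ^ 2 = z.im := by field_simp
  have h2 : 0 ≤ z.im⁻¹ * (t - z.re) ^ 2 := by positivity
  rw [mul_add]; linarith

lemma pk_eq (z : ℂ) (t : ℝ) : ((z - (t : ℂ))⁻¹).im = - pk z t := by
  unfold pk
  simp [Complex.inv_im, Complex.normSq_apply]
  rw [neg_div]; congr 2; ring

lemma pk_pdf {z : ℂ} (hz : 0 < z.im) (t : ℝ) :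
    pk z t = Real.pi * ProbabilityTheory.cauchyPDFReal z.re z.im.toNNReal t := by
  rw [ProbabilityTheory.cauchyPDFReal_def, Real.coe_toNNReal _ hz.le, pk]
  field_simp

lemma pk_integrable {z : ℂ} (hz : 0 < z.im) : Integrable (pk z) := by
  have h := (ProbabilityTheory.integrable_cauchyPDFReal z.re (γ := z.im.toNNReal)).const_mul Real.pi
  exact h.congr (Eventually.of_forall fun t => (pk_pdf hz t).symm)

lemma pk_integral {z : ℂ} (hz : 0 < z.im) : ∫ t, pk z t = Real.pi := by
  have h := ProbabilityTheory.integral_cauchyPDFReal_eq_one z.re (γ := z.im.toNNReal)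
    (by simpa using hz)
  simp_rw [pk_pdf hz, integral_const_mul, h, mul_one]

lemma sub_ne {z : ℂ} (hz : 0 < z.im) (t : ℝ) : z - (t : ℂ) ≠ 0 := by
  intro h
  have := congrArg Complex.im h
  simp at this; linarith

lemma norm_inv_le {z : ℂ} (hz : 0 < z.im) (t : ℝ) : ‖(z - (t : ℂ))⁻¹‖ ≤ z.im⁻¹ := by
  rw [norm_inv]
  apply inv_anti₀ hz
  have := Complex.abs_im_le_norm (z - t)
  simp at this
  exact (le_abs_self _).trans this

lemma inv_cont {z : ℂ} (hz : 0 < z.im) : Continuous fun t : ℝ => (z - (t : ℂ))⁻¹ :=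
  Continuous.inv₀ (by fun_prop) (sub_ne hz)

lemma inv_integrable (μ : Measure ℝ) [IsProbabilityMeasure μ] {z : ℂ} (hz : 0 < z.im) :
    Integrable (fun t : ℝ => (z - (t : ℂ))⁻¹) μ :=
  Integrable.of_bound (inv_cont hz).aestronglyMeasurable _ (Eventually.of_forall (norm_inv_le hz))

lemma pk_integrable' (μ : Measure ℝ) [IsProbabilityMeasure μ] {z : ℂ} (hz : 0 < z.im) :
    Integrable (pk z) μ :=
  Integrable.of_bound (pk_cont hz).aestronglyMeasurable z.im⁻¹ (Eventually.of_forall fun t => by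
    rw [Real.norm_of_nonneg (pk_pos hz t).le]; exact pk_le hz t)

lemma cauchy_norm_le (μ : Measure ℝ) [IsProbabilityMeasure μ] {z : ℂ} (hz : 0 < z.im) :
    ‖cauchy μ z‖ ≤ z.im⁻¹ := by
  have := norm_integral_le_of_norm_le_const (μ := μ) (Eventually.of_forall (norm_inv_le hz))
  simpa [cauchy] using this

lemma cauchy_im (μ : Measure ℝ) [IsProbabilityMeasure μ] {z : ℂ} (hz : 0 < z.im) :
    (cauchy μ z).im = - ∫ t, pk z t ∂μ := by
  have := Complex.imCLM.integral_comp_comm (inv_integrable μ hz)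
  simp only [Complex.imCLM_apply, pk_eq, integral_neg] at this
  exact this.symm

lemma cauchy_im_neg (μ : Measure ℝ) [IsProbabilityMeasure μ] {z : ℂ} (hz : 0 < z.im) :
    (cauchy μ z).im < 0 := by
  rw [cauchy_im μ hz, neg_lt_zero, integral_pos_iff_support_of_nonneg
    (fun t => (pk_pos hz t).le) (pk_integrable' μ hz)]
  have : Function.support (pk z) = Set.univ := by
    ext t; simp [(pk_pos hz t).ne']
  simp [this]

lemma isOpen_uhp : IsOpen {z : ℂ | 0 < z.im} := isOpen_lt continuous_const Complex.continuous_im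

lemma cauchy_diff (μ : Measure ℝ) [IsProbabilityMeasure μ] :
    DifferentiableOn ℂ (cauchy μ) {z | 0 < z.im} := by
  intro z hz
  have h : cauchy μ = fun w => - resolventTransform μ w := by
    ext w
    simp only [cauchy, resolventTransform_apply, resolvent, Ring.inverse_eq_inv', ← integral_neg]
    congr 1
    ext t
    rw [← inv_neg]; simp
  have hz' : z ∉ algebraMap ℝ ℂ '' μ.support := by
    rintro ⟨t, -, rfl⟩
    simp at hz
  rw [h]
  exact (hasDerivAt_resolventTransform z hz').differentiableAt.neg.differentiableWithinAt

lemma cauchy_lim (μ : Measure ℝ) [IsProbabilityMeasure μ] :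
    Tendsto (fun y : ℝ => (y : ℂ) * (I * cauchy μ (y * I))) atTop (𝓝 1) := by
  have h1 : ∀ y : ℝ, (y : ℂ) * (I * cauchy μ (y * I)) =
      ∫ t : ℝ, ((y : ℂ) * I) * ((y : ℂ) * I - (t : ℂ))⁻¹ ∂μ := by
    intro y; rw [integral_const_mul, cauchy, mul_assoc]
  have h2 : (1 : ℂ) = ∫ t : ℝ, (1 : ℂ) ∂μ := by simp
  simp_rw [h1]
  rw [h2]
  refine tendsto_integral_filter_of_dominated_convergence (fun _ => 1) ?_ ?_ (by simp) ?_
  · filter_upwards [eventually_gt_atTop 0] with y hy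
    exact (continuous_const.mul (inv_cont (by simpa using hy))).aestronglyMeasurable
  · filter_upwards [eventually_gt_atTop 0] with y hy
    refine Eventually.of_forall fun t => ?_
    have := norm_inv_le (z := y * I) (by simpa using hy) t
    rw [norm_mul]
    calc _ ≤ y * (y)⁻¹ := by
          gcongr
          · simp [abs_of_pos hy]
          · simpa using this
      _ = 1 := by field_simp
  · refine Eventually.of_forall fun t => ?_
    have h3 : Tendsto (fun y : ℝ => (1 - (t : ℂ) * ((y⁻¹ : ℝ) : ℂ) * (-I))⁻¹) atTop (𝓝 1) := by
      have h4 : Tendsto (fun y : ℝ => ((y⁻¹ : ℝ) : ℂ)) atTop (𝓝 ((0 : ℝ) : ℂ)) :=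
        (Complex.continuous_ofReal.tendsto 0).comp tendsto_inv_atTop_zero
      have h5 := ((tendsto_const_nhds (x := (1 : ℂ))).sub
        ((h4.const_mul (t : ℂ)).mul_const (-I))).inv₀ (by simp)
      simpa using h5
    refine h3.congr' ?_
    filter_upwards [eventually_gt_atTop 0] with y hy
    have hy' : (y : ℂ) ≠ 0 := by exact_mod_cast hy.ne'
    have hne := sub_ne (z := y * I) (by simpa using hy) t
    have e : (1 - (t : ℂ) * ((y⁻¹ : ℝ) : ℂ) * (-I)) = ((y : ℂ) * I - t) * ((y : ℂ) * I)⁻¹ := by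
      rw [sub_mul, mul_inv_cancel₀ (by simp [hy'])]
      rw [mul_inv, Complex.inv_I]; push_cast; ring
    rw [e, mul_inv, inv_inv, mul_comm]

lemma pk_complex (z : ℂ) (t : ℝ) (hz : 0 < z.im) :
    ((t : ℂ) - z)⁻¹ * ((z.im : ℂ) / ((t : ℂ) - (starRingEnd ℂ) z)) = (pk z t : ℂ) := by
  have h : ((t : ℂ) - z) * ((t : ℂ) - (starRingEnd ℂ) z) = (((t - z.re) ^ 2 + z.im ^ 2 : ℝ) : ℂ) := by
    apply Complex.ext
    · rw [Complex.ofReal_re]; simp; ring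
    · rw [Complex.ofReal_im]; simp; ring
  rw [pk, Complex.ofReal_div, ← h, mul_comm, div_mul_eq_mul_div, ← div_eq_mul_inv, div_div]

/-- Poisson formula for bounded holomorphic functions. -/
lemma poisson (h : ℂ → ℂ) (e : ℝ) (he : 0 < e) (hd : DifferentiableOn ℂ h {w | -e < w.im})
    (C : ℝ) (hC : ∀ w : ℂ, 0 ≤ w.im → ‖h w‖ ≤ C) (z : ℂ) (hz : 0 < z.im) :
    Integrable (fun t : ℝ => h t * (pk z t : ℂ)) ∧
    ∫ t : ℝ, h t * (pk z t : ℂ) = Real.pi * h z := by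
  have hC0 : 0 ≤ C := (norm_nonneg _).trans (hC z hz.le)
  have hcont : Continuous fun t : ℝ => h t := by
    rw [← continuousOn_univ]
    refine hd.continuousOn.comp (by fun_prop) ?_
    intro t _; simpa using he
  have hint : Integrable (fun t : ℝ => h t * (pk z t : ℂ)) := by
    refine Integrable.bdd_mul (c := C) (pk_integrable hz).ofReal hcont.aestronglyMeasurable
      (Eventually.of_forall fun t => hC t (by simp))
  refine ⟨hint, ?_⟩
  set φ : ℂ → ℂ := fun w => dslope h z w * ((z.im : ℂ) / (w - (starRingEnd ℂ) z)) with hφ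
  have hsd : DifferentiableOn ℂ (dslope h z) {w | -e < w.im} := by
    rw [Complex.differentiableOn_dslope]
    · exact hd
    · exact (isOpen_lt continuous_const Complex.continuous_im).mem_nhds
        (show -e < z.im by linarith)
  have hφd : DifferentiableOn ℂ φ {w | 0 ≤ w.im} := by
    refine (hsd.mono fun w hw => ?_).mul (DifferentiableOn.div (by fun_prop) (by fun_prop) ?_)
    · simp only [Set.mem_ofPred_eq] at *; linarith
    · intro w hw h0
      have := congrArg Complex.im h0
      simp at this hw; linarith
  have hφt : ∀ t : ℝ, φ t = h t * (pk z t : ℂ) - h z * (pk z t : ℂ) := by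
    intro t
    have hne : (t : ℂ) ≠ z := by
      intro h0; have := congrArg Complex.im h0; simp at this; linarith
    simp only [hφ, dslope_of_ne h hne, slope, vsub_eq_sub, smul_eq_mul]
    rw [← sub_mul, ← pk_complex z t hz]; ring
  have hφi : Integrable (fun t : ℝ => φ t) := by
    simp_rw [hφt]
    exact hint.sub ((pk_integrable hz).ofReal.const_mul _)
  -- decay
  have hdec : ∀ R : ℝ, ‖z‖ < R → ∀ w : ℂ, 0 ≤ w.im → R ≤ ‖w‖ →
      ‖φ w‖ ≤ (2 * C * z.im) / (R - ‖z‖) ^ 2 := by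
    intro R hR w hw hRw
    have hne : w ≠ z := by rintro rfl; linarith
    have hR' : 0 < R - ‖z‖ := by linarith
    have h1 : R - ‖z‖ ≤ ‖w - z‖ := by
      have := norm_sub_norm_le w z; linarith
    have h2 : R - ‖z‖ ≤ ‖w - (starRingEnd ℂ) z‖ := by
      have := norm_sub_norm_le w ((starRingEnd ℂ) z)
      rw [Complex.norm_conj] at this; linarith
    simp only [hφ, dslope_of_ne h hne, slope, vsub_eq_sub, smul_eq_mul]
    rw [norm_mul, norm_mul, norm_inv, norm_div, Complex.norm_real, Real.norm_of_nonneg hz.le]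
    have h3 : ‖h w - h z‖ ≤ 2 * C := by
      have := norm_sub_le (h w) (h z)
      have := hC w hw
      have := hC z hz.le
      linarith
    calc _ ≤ (R - ‖z‖)⁻¹ * (2 * C) * (z.im / (R - ‖z‖)) := by
            gcongr
      _ = _ := by field_simp
  have key : Tendsto (fun R : ℝ => ∫ t in (-R)..R, φ t) atTop (𝓝 0) := by
    have hlim : Tendsto (fun R : ℝ => 4 * R * ((2 * C * z.im) / (R - ‖z‖) ^ 2)) atTop (𝓝 0) := by
      have a1 : Tendsto (fun R : ℝ => R - ‖z‖) atTop atTop :=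
        tendsto_atTop_add_const_right _ _ tendsto_id
      have a2 := tendsto_inv_atTop_zero.comp a1
      have a3 : Tendsto (fun R : ℝ => 8 * C * z.im * ((R - ‖z‖)⁻¹ + ‖z‖ * ((R - ‖z‖)⁻¹ * (R - ‖z‖)⁻¹)))
          atTop (𝓝 (8 * C * z.im * (0 + ‖z‖ * (0 * 0)))) :=
        (a2.add ((a2.mul a2).const_mul _)).const_mul _
      simp only [mul_zero, add_zero] at a3
      refine a3.congr' ?_
      filter_upwards [eventually_gt_atTop ‖z‖] with R hR
      have : R - ‖z‖ ≠ 0 := by linarith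
      field_simp
      ring
    refine squeeze_zero_norm' ?_ hlim
    filter_upwards [eventually_gt_atTop ‖z‖] with R hR
    have hR0 : 0 < R := (norm_nonneg z).trans_lt hR
    have hrect := Complex.integral_boundary_rect_eq_zero_of_differentiableOn φ (-R : ℝ) (R + R * I)
      (hφd.mono (by
        intro w hw
        have := hw.2
        simp [Set.uIcc_of_le hR0.le] at this
        exact this.1))
    simp at hrect
    set K := (2 * C * z.im) / (R - ‖z‖) ^ 2 with hK
    have b1 : ‖∫ x in (-R)..R, φ (x + R * I)‖ ≤ K * |R - (-R)| := by
      refine intervalIntegral.norm_integral_le_of_norm_le_const fun x _ => ?_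
      refine hdec R hR _ (by simpa using hR0.le) ?_
      have := Complex.abs_im_le_norm (x + R * I)
      simp at this
      exact (le_abs_self R).trans this
    have b2 : ‖∫ y in (0 : ℝ)..R, φ (R + y * I)‖ ≤ K * |R - 0| := by
      refine intervalIntegral.norm_integral_le_of_norm_le_const fun y hy => ?_
      rw [Set.uIoc_of_le hR0.le] at hy
      refine hdec R hR _ (by simpa using hy.1.le) ?_
      have := Complex.abs_re_le_norm (R + y * I)
      simp at this
      exact (le_abs_self R).trans this
    have b3 : ‖∫ y in (0 : ℝ)..R, φ (-R + y * I)‖ ≤ K * |R - 0| := by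
      refine intervalIntegral.norm_integral_le_of_norm_le_const fun y hy => ?_
      rw [Set.uIoc_of_le hR0.le] at hy
      refine hdec R hR _ (by simpa using hy.1.le) ?_
      have := Complex.abs_re_le_norm (-R + y * I)
      simp at this
      exact (le_abs_self R).trans this
    have e1 : (∫ x in (-R)..R, φ x) = (∫ x in (-R)..R, φ (x + R * I))
        - I * (∫ y in (0 : ℝ)..R, φ (R + y * I)) + I * (∫ y in (0 : ℝ)..R, φ (-R + y * I)) := by
      linear_combination hrect
    rw [e1]
    have c1 := norm_add_le ((∫ x in (-R)..R, φ (x + R * I))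
        - I * (∫ y in (0 : ℝ)..R, φ (R + y * I))) (I * (∫ y in (0 : ℝ)..R, φ (-R + y * I)))
    have c2 := norm_sub_le (∫ x in (-R)..R, φ (x + R * I)) (I * (∫ y in (0 : ℝ)..R, φ (R + y * I)))
    rw [norm_mul, Complex.norm_I, one_mul] at c1 c2
    have r1 : |R - (-R)| = 2 * R := by rw [abs_of_pos] <;> linarith
    have r2 : |R - 0| = R := by rw [sub_zero, abs_of_pos hR0]
    rw [r1] at b1; rw [r2] at b2 b3
    linarith
  have key2 := intervalIntegral_tendsto_integral hφi tendsto_neg_atTop_atBot tendsto_id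
  have h0 : ∫ t : ℝ, φ t = 0 := tendsto_nhds_unique key2 key
  simp_rw [hφt] at h0
  have hc : Integrable (fun t : ℝ => h z * (pk z t : ℂ)) := (pk_integrable hz).ofReal.const_mul _
  rw [integral_sub hint hc, integral_const_mul,
    integral_complex_ofReal, pk_integral hz] at h0
  linear_combination h0

lemma u_lim {g : ℂ → ℂ}
    (hlim : Tendsto (fun y : ℝ => (y : ℂ) * (I * g (y * I))) atTop (𝓝 1)) :
    Tendsto (fun y : ℝ => y * -(g (y * I)).im) atTop (𝓝 1) := by
  have := (Complex.continuous_re.tendsto _).comp hlim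
  simpa [Function.comp_def] using this

lemma pk_I {s : ℝ} (t : ℝ) : s * pk (s * I) t = s ^ 2 / (t ^ 2 + s ^ 2) := by
  simp [pk]; ring

lemma smooth_measure (g : ℂ → ℂ) (hd : DifferentiableOn ℂ g {z | 0 < z.im})
    (hb : ∀ z : ℂ, 0 < z.im → ‖g z‖ ≤ z.im⁻¹) (him : ∀ z : ℂ, 0 < z.im → (g z).im < 0)
    (hlim : Tendsto (fun y : ℝ => (y : ℂ) * (I * g (y * I))) atTop (𝓝 1))
    (e : ℝ) (he : 0 < e) :
    ∃ ρ : ProbabilityMeasure ℝ, ∀ z : ℂ, 0 < z.im →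
      ∫ t, pk z t ∂(ρ : Measure ℝ) = -(g (z + e * I)).im := by
  set h : ℂ → ℂ := fun w => g (w + e * I) with hh
  have hhd : DifferentiableOn ℂ h {w | -e < w.im} := by
    refine hd.comp (by fun_prop) ?_
    intro w hw
    simp at hw ⊢; linarith
  have hhb : ∀ w : ℂ, 0 ≤ w.im → ‖h w‖ ≤ e⁻¹ := by
    intro w hw
    refine (hb _ (by simp; linarith)).trans ?_
    apply inv_anti₀ he
    simp; linarith
  have hP := poisson h e he hhd e⁻¹ hhb
  set p : ℝ → ℝ := fun t => Real.pi⁻¹ * -(h t).im with hp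
  have hcont : Continuous fun t : ℝ => h t := by
    rw [← continuousOn_univ]
    refine hhd.continuousOn.comp (by fun_prop) ?_
    intro t _; simpa using he
  have hpc : Continuous p := by
    have := Complex.continuous_im.comp hcont
    exact continuous_const.mul this.neg
  have hp0 : ∀ t, 0 ≤ p t := by
    intro t
    have := him (t + e * I) (by simpa using he)
    have hpi := Real.pi_pos
    simp only [hp, hh]
    exact mul_nonneg (by positivity) (by linarith)
  have hPi : ∀ z : ℂ, 0 < z.im → Integrable (fun t => p t * pk z t) ∧
      ∫ t, p t * pk z t = -(h z).im := by
    intro z hz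
    obtain ⟨i1, i2⟩ := hP z hz
    have e1 : ∀ t : ℝ, p t * pk z t = -Real.pi⁻¹ * (h t * (pk z t : ℂ)).im := by
      intro t; simp [hp, Complex.mul_im]; ring
    have i3 : Integrable (fun t : ℝ => (h t * (pk z t : ℂ)).im) := i1.im
    have i4 := Complex.imCLM.integral_comp_comm i1
    simp only [Complex.imCLM_apply] at i4
    simp_rw [e1]
    refine ⟨i3.const_mul _, ?_⟩
    rw [integral_const_mul, i4, i2, Complex.im_ofReal_mul]
    have hpi := Real.pi_pos
    field_simp
  have hmass : ∫⁻ t, ENNReal.ofReal (p t) = 1 := by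
    have m1 : Tendsto (fun n : ℕ => ∫⁻ t, ENNReal.ofReal (p t * (((n : ℝ) + 1) * pk (((n : ℝ) + 1 : ℝ) * I) t)))
        atTop (𝓝 (∫⁻ t, ENNReal.ofReal (p t))) := by
      refine lintegral_tendsto_of_tendsto_of_monotone ?_ ?_ ?_
      · intro n
        have := pk_cont (z := ((n : ℝ) + 1 : ℝ) * I) (by simp; positivity)
        exact (ENNReal.continuous_ofReal.comp (hpc.mul (continuous_const.mul this))).aemeasurable
      · refine Eventually.of_forall fun t n m hnm => ?_
        apply ENNReal.ofReal_le_ofReal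
        apply mul_le_mul_of_nonneg_left _ (hp0 t)
        rw [pk_I, pk_I, div_le_div_iff₀ (by positivity) (by positivity)]
        have : ((n : ℝ) + 1) ^ 2 ≤ ((m : ℝ) + 1) ^ 2 := by gcongr
        nlinarith [sq_nonneg t]
      · refine Eventually.of_forall fun t => ?_
        apply ENNReal.tendsto_ofReal
        have a0 : Tendsto (fun n : ℕ => (n : ℝ) + 1) atTop atTop :=
          tendsto_atTop_add_const_right _ _ tendsto_natCast_atTop_atTop
        have a1 := tendsto_inv_atTop_zero.comp a0
        have a2 : Tendsto (fun n : ℕ => p t * (1 / ((t * ((n : ℝ) + 1)⁻¹) ^ 2 + 1))) atTop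
            (𝓝 (p t * (1 / ((t * 0) ^ 2 + 1)))) :=
          (tendsto_const_nhds.div (((a1.const_mul t).pow 2).add_const 1) (by simp)).const_mul _
        simp only [mul_zero, ne_eq, OfNat.ofNat_ne_zero, not_false_eq_true, zero_pow, zero_add,
          div_one, mul_one] at a2
        refine a2.congr fun n => ?_
        rw [pk_I]
        field_simp
    have m2 : Tendsto (fun n : ℕ => ∫⁻ t, ENNReal.ofReal (p t * (((n : ℝ) + 1) * pk (((n : ℝ) + 1 : ℝ) * I) t)))
        atTop (𝓝 (ENNReal.ofReal 1)) := by
      have a0 : Tendsto (fun n : ℕ => (n : ℝ) + 1) atTop atTop :=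
          tendsto_atTop_add_const_right _ _ tendsto_natCast_atTop_atTop
      have a00 : Tendsto (fun n : ℕ => (n : ℝ) + 1 + e) atTop atTop :=
          tendsto_atTop_add_const_right _ _ a0
      have a1 := (u_lim hlim).comp a00
      have a2 := tendsto_inv_atTop_zero.comp a00
      have a3 := a1.mul ((tendsto_const_nhds (x := (1 : ℝ))).sub (a2.const_mul e))
      simp only [mul_zero, sub_zero, mul_one] at a3
      refine (ENNReal.tendsto_ofReal a3).congr fun n => ?_
      have hn : 0 < ((((n : ℝ) + 1 : ℝ) : ℂ) * I).im := by simp; positivity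
      obtain ⟨i1, i2⟩ := hPi _ hn
      have e1 : ∀ t, p t * (((n : ℝ) + 1) * pk (((n : ℝ) + 1 : ℝ) * I) t) =
        ((n : ℝ) + 1) * (p t * pk (((n : ℝ) + 1 : ℝ) * I) t) := fun t => by ring
      simp_rw [e1]
      rw [← ofReal_integral_eq_lintegral_ofReal (i1.const_mul _)
        (Eventually.of_forall fun t => mul_nonneg (by positivity)
          (mul_nonneg (hp0 t) (pk_pos hn t).le)), integral_const_mul, i2]
      congr 1
      simp only [Function.comp_apply, hh]
      have e2 : ((((n : ℝ) + 1 : ℝ) : ℂ) * I) + e * I = ((n : ℝ) + 1 + e : ℝ) * I := by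
        push_cast; ring
      rw [e2]
      have : (n : ℝ) + 1 + e ≠ 0 := by positivity
      field_simp
      ring
    rw [tendsto_nhds_unique m1 m2]; simp
  have hprob : IsProbabilityMeasure (volume.withDensity fun t => ENNReal.ofReal (p t)) :=
    ⟨by rw [withDensity_apply _ MeasurableSet.univ]; simpa using hmass⟩
  refine ⟨⟨_, hprob⟩, fun z hz => ?_⟩
  have := integral_withDensity_eq_integral_toReal_smul (μ := (volume : Measure ℝ))
    (f := fun t => ENNReal.ofReal (p t)) (hpc.measurable.ennreal_ofReal) (by simp) (pk z)
  simp only [ProbabilityMeasure.coe_mk]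
  rw [this, ← (hPi z hz).2]
  refine integral_congr_ae (Eventually.of_forall fun t => ?_)
  simp [ENNReal.toReal_ofReal (hp0 t)]

lemma limit_measure (g : ℂ → ℂ) (hd : DifferentiableOn ℂ g {z | 0 < z.im})
    (hb : ∀ z : ℂ, 0 < z.im → ‖g z‖ ≤ z.im⁻¹) (him : ∀ z : ℂ, 0 < z.im → (g z).im < 0)
    (hlim : Tendsto (fun y : ℝ => (y : ℂ) * (I * g (y * I))) atTop (𝓝 1)) :
    ∃ ρ : Measure ℝ, IsProbabilityMeasure ρ ∧ ∀ z : ℂ, 0 < z.im →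
      ∫ t, pk z t ∂ρ = -(g z).im := by
  have hpos : ∀ n : ℕ, (0 : ℝ) < 1 / ((n : ℝ) + 1) := fun n => by positivity
  choose ρ hρ using fun n : ℕ => smooth_measure g hd hb him hlim (1 / ((n : ℝ) + 1)) (hpos n)
  have hconv : ∀ z : ℂ, 0 < z.im → Tendsto (fun n : ℕ =>
      -(g (z + (1 / ((n : ℝ) + 1) : ℝ) * I)).im) atTop (𝓝 (-(g z).im)) := by
    intro z hz
    have c1 : ContinuousAt g z := (hd.differentiableAt (isOpen_uhp.mem_nhds hz)).continuousAt
    have c2 : Tendsto (fun n : ℕ => z + (1 / ((n : ℝ) + 1) : ℝ) * I) atTop (𝓝 z) := by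
      have a := (Complex.continuous_ofReal.tendsto 0).comp
        (tendsto_one_div_add_atTop_nhds_zero_nat (𝕜 := ℝ))
      have := (a.mul_const I).const_add z
      simpa [Function.comp_def] using this
    exact ((Complex.continuous_im.tendsto _).comp (c1.tendsto.comp c2)).neg
  have htight : IsTightMeasureSet (Set.range fun n => (ρ n : Measure ℝ)) := by
    apply isTightMeasureSet_range_of_tendsto_limsup_measure_norm_gt
    have l1 : Tendsto (fun r : ℝ => ENNReal.ofReal (2 * (1 - r * -(g (r * I)).im))) atTop (𝓝 0) := by
      have := ENNReal.tendsto_ofReal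
        (((tendsto_const_nhds (x := (1 : ℝ))).sub (u_lim hlim)).const_mul 2)
      simpa using this
    refine tendsto_of_tendsto_of_tendsto_of_le_of_le' tendsto_const_nhds l1
      (Eventually.of_forall fun _ => zero_le) ?_
    filter_upwards [eventually_gt_atTop 0] with r hr
    have hr' : 0 < ((r : ℂ) * I).im := by simpa using hr
    have l2 := ENNReal.tendsto_ofReal
        (((tendsto_const_nhds (x := (1 : ℝ))).sub ((hconv _ hr').const_mul r)).const_mul 2)
    rw [← l2.limsup_eq]
    refine limsup_le_limsup (Eventually.of_forall fun n => ?_)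
    simp only
    rw [← hρ n _ hr']
    have hi := pk_integrable' (ρ n : Measure ℝ) hr'
    have hm := mul_meas_ge_le_integral_of_nonneg (μ := (ρ n : Measure ℝ))
      (f := fun t => 1 - r * pk (r * I) t) (Eventually.of_forall fun t => by
        simp only [pk_I, Pi.zero_apply, sub_nonneg]
        exact div_le_one_of_le₀ (by nlinarith [sq_nonneg t]) (by positivity))
      ((integrable_const _).sub (hi.const_mul r)) (1 / 2)
    rw [integral_sub (integrable_const _) (hi.const_mul r), integral_const_mul] at hm
    simp only [integral_const, probReal_univ, smul_eq_mul, mul_one] at hm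
    rw [← ENNReal.ofReal_toReal (measure_ne_top (ρ n : Measure ℝ) {x | r < ‖x‖})]
    apply ENNReal.ofReal_le_ofReal
    have hsub : (ρ n : Measure ℝ).real {x | r < ‖x‖} ≤
        (ρ n : Measure ℝ).real {t | 1 / 2 ≤ 1 - r * pk (r * I) t} := by
      apply measureReal_mono _ (measure_ne_top _ _)
      intro t ht
      simp only [Set.mem_ofPred_eq, Real.norm_eq_abs] at ht ⊢
      have : r ^ 2 ≤ t ^ 2 := by rw [← sq_abs t]; gcongr
      rw [pk_I, le_sub_comm, div_le_iff₀ (by positivity)]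
      linarith
    have : (ρ n : Measure ℝ).real {x | r < ‖x‖} = ((ρ n : Measure ℝ) {x | r < ‖x‖}).toReal := rfl
    rw [← this]
    linarith
  have hcomp : IsCompact (closure (Set.range ρ)) := by
    apply isCompact_closure_of_isTightMeasureSet
    convert htight using 1
    ext m; simp
  let U : Ultrafilter ℕ := Ultrafilter.of atTop
  have hU : (U : Filter ℕ) ≤ atTop := Ultrafilter.of_le atTop
  obtain ⟨ρ₀, -, hρ₀⟩ := hcomp.ultrafilter_le_nhds' (U.map ρ) (by
    rw [Ultrafilter.mem_map]
    exact Filter.univ_mem' fun n => subset_closure ⟨n, rfl⟩)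
  have hT : Tendsto ρ U (𝓝 ρ₀) := hρ₀
  refine ⟨ρ₀, inferInstance, fun z hz => ?_⟩
  rw [ProbabilityMeasure.tendsto_iff_forall_integral_tendsto] at hT
  have h1 := hT (BoundedContinuousFunction.ofNormedAddCommGroup (pk z) (pk_cont hz) z.im⁻¹
    (fun t => by rw [Real.norm_of_nonneg (pk_pos hz t).le]; exact pk_le hz t))
  simp only [BoundedContinuousFunction.coe_ofNormedAddCommGroup, hρ _ z hz] at h1
  exact tendsto_nhds_unique h1 ((hconv z hz).mono_left hU)

lemma nevanlinna (g : ℂ → ℂ) (hd : DifferentiableOn ℂ g {z | 0 < z.im})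
    (hb : ∀ z : ℂ, 0 < z.im → ‖g z‖ ≤ z.im⁻¹) (him : ∀ z : ℂ, 0 < z.im → (g z).im < 0)
    (hlim : Tendsto (fun y : ℝ => (y : ℂ) * (I * g (y * I))) atTop (𝓝 1)) :
    ∃ ρ : Measure ℝ, IsProbabilityMeasure ρ ∧ ∀ z : ℂ, 0 < z.im → cauchy ρ z = g z := by
  obtain ⟨ρ, hρ, h⟩ := limit_measure g hd hb him hlim
  refine ⟨ρ, hρ, ?_⟩
  have hconv : Convex ℝ {z : ℂ | 0 < z.im} := convex_halfSpace_im_gt 0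
  have hdd := (cauchy_diff ρ).sub hd
  obtain ⟨c, hc⟩ := AnalyticOnNhd.eq_const_of_im_eq_const (c₀ := 0)
    (hdd.analyticOnNhd isOpen_uhp) (fun z hz => by
      simp only [Pi.sub_apply, Complex.sub_im]
      rw [cauchy_im ρ hz, h z hz]; ring) isOpen_uhp ⟨⟨I, by simp⟩, hconv.isPreconnected⟩
  have hc0 : c = 0 := by
    have l1 : Tendsto (fun y : ℝ => c) atTop (𝓝 0) := by
      have hl : Tendsto (fun y : ℝ => 2 * y⁻¹) atTop (𝓝 0) := by
        simpa using tendsto_inv_atTop_zero.const_mul (2 : ℝ)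
      refine squeeze_zero_norm' ?_ hl
      filter_upwards [eventually_gt_atTop 0] with y hy
      have hy' : 0 < ((y : ℂ) * I).im := by simpa using hy
      have e1 := hc ((y : ℂ) * I) hy'
      rw [← e1]
      have b1 := cauchy_norm_le ρ hy'
      have b2 := hb _ hy'
      have b3 := norm_sub_le (cauchy ρ (y * I)) (g (y * I))
      simp at b1 b2
      simp only [Pi.sub_apply]
      linarith
    exact tendsto_nhds_unique tendsto_const_nhds l1
  intro z hz
  have := hc z hz
  simp only [Pi.sub_apply, hc0] at this
  exact sub_eq_zero.mp this

lemma exists_root (μ ν : Measure ℝ) [IsProbabilityMeasure μ] [IsProbabilityMeasure ν] :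
    ∃ ρ : Measure ℝ, IsProbabilityMeasure ρ ∧
      ∀ z : ℂ, 0 < z.im → (cauchy ρ z) ^ 2 = cauchy μ z * cauchy ν z := by
  have hre : ∀ (μ : Measure ℝ) [IsProbabilityMeasure μ] (z : ℂ), 0 < z.im →
      0 < (I * cauchy μ z).re := by
    intro μ _ z hz
    have := cauchy_im_neg μ hz
    simpa using this
  have hne : ∀ (μ : Measure ℝ) [IsProbabilityMeasure μ] (z : ℂ), 0 < z.im →
      I * cauchy μ z ≠ 0 := by
    intro μ _ z hz h0
    have := hre μ z hz
    rw [h0] at this; simp at this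
  set g : ℂ → ℂ := fun z =>
    -I * Complex.exp ((Complex.log (I * cauchy μ z) + Complex.log (I * cauchy ν z)) / 2) with hg
  have hsq : ∀ z : ℂ, 0 < z.im → g z ^ 2 = cauchy μ z * cauchy ν z := by
    intro z hz
    simp only [hg]
    rw [mul_pow, ← Complex.exp_nat_mul]
    have : ((2 : ℕ) : ℂ) * ((Complex.log (I * cauchy μ z) + Complex.log (I * cauchy ν z)) / 2)
      = Complex.log (I * cauchy μ z) + Complex.log (I * cauchy ν z) := by push_cast; ring
    rw [this, Complex.exp_add, Complex.exp_log (hne μ z hz), Complex.exp_log (hne ν z hz)]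
    linear_combination (I ^ 2 - 1) * cauchy μ z * cauchy ν z * Complex.I_sq
  have hlogd : ∀ (μ : Measure ℝ) [IsProbabilityMeasure μ],
      DifferentiableOn ℂ (fun z => Complex.log (I * cauchy μ z)) {z | 0 < z.im} := by
    intro μ _
    refine DifferentiableOn.clog ((cauchy_diff μ).const_mul I) fun z hz => ?_
    exact Or.inl (hre μ z hz)
  suffices H : ∃ ρ : Measure ℝ, IsProbabilityMeasure ρ ∧ ∀ z : ℂ, 0 < z.im → cauchy ρ z = g z by
    obtain ⟨ρ, hρ, h⟩ := H
    exact ⟨ρ, hρ, fun z hz => by rw [h z hz, hsq z hz]⟩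
  refine nevanlinna g ?_ ?_ ?_ ?_
  · exact ((((hlogd μ).add (hlogd ν)).div_const 2).cexp).const_mul (-I)
  · intro z hz
    have h1 : ‖g z‖ ^ 2 ≤ z.im⁻¹ ^ 2 := by
      rw [← norm_pow, hsq z hz, norm_mul, sq]
      exact mul_le_mul (cauchy_norm_le μ hz) (cauchy_norm_le ν hz) (norm_nonneg _) (by positivity)
    exact (sq_le_sq₀ (norm_nonneg _) (by positivity)).mp h1
  · intro z hz
    have a1 := Complex.abs_arg_lt_pi_div_two_iff.mpr (Or.inl (hre μ z hz))
    have a2 := Complex.abs_arg_lt_pi_div_two_iff.mpr (Or.inl (hre ν z hz))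
    rw [abs_lt] at a1 a2
    have : 0 < (Complex.exp ((Complex.log (I * cauchy μ z) + Complex.log (I * cauchy ν z)) / 2)).re := by
      rw [Complex.exp_re]
      refine mul_pos (Real.exp_pos _) (Real.cos_pos_of_mem_Ioo ?_)
      have : ((Complex.log (I * cauchy μ z) + Complex.log (I * cauchy ν z)) / 2).im =
        ((I * cauchy μ z).arg + (I * cauchy ν z).arg) / 2 := by
        rw [show (2 : ℂ) = ((2 : ℝ) : ℂ) by norm_num, Complex.div_ofReal_im]
        simp only [Complex.add_im, Complex.log_im]
      rw [this]
      constructor <;> linarith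
    simp only [hg, Complex.mul_im, Complex.neg_re, Complex.neg_im, Complex.I_re, Complex.I_im]
    linarith
  · have t : ∀ (μ : Measure ℝ) [IsProbabilityMeasure μ],
        Tendsto (fun y : ℝ => Complex.log ((y : ℂ) * (I * cauchy μ (y * I)))) atTop (𝓝 0) := by
      intro μ _
      have := (continuousAt_clog (x := 1) (by simp)).tendsto.comp (cauchy_lim μ)
      simpa [Function.comp_def] using this
    have t2 := (Complex.continuous_exp.tendsto _).comp (((t μ).add (t ν)).div_const 2)
    simp only [add_zero, zero_div, Complex.exp_zero] at t2
    refine t2.congr' ?_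
    filter_upwards [eventually_gt_atTop 0] with y hy
    have hy' : 0 < ((y : ℂ) * I).im := by simpa using hy
    simp only [Function.comp_apply, hg]
    rw [Complex.log_ofReal_mul hy (hne μ _ hy'), Complex.log_ofReal_mul hy (hne ν _ hy')]
    have e1 : ∀ a b : ℂ, ((Real.log y : ℂ) + a + ((Real.log y : ℂ) + b)) / 2
      = (Real.log y : ℂ) + (a + b) / 2 := fun a b => by ring
    rw [e1, Complex.exp_add, ← Complex.ofReal_exp, Real.exp_log hy]
    linear_combination (y : ℂ) * Complex.exp ((Complex.log (I * cauchy μ (y * I)) + Complex.log (I * cauchy ν (y * I))) / 2) * Complex.I_sq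

lemma inner_int (f : BoundedContinuousFunction ℝ ℝ) (t e : ℝ) (he : 0 < e) :
    ∫ x, f x * pk (t + e * I) x = ∫ s, f (t + e * s) * (1 + s ^ 2)⁻¹ := by
  have h1 := integral_add_left_eq_self (μ := (volume : Measure ℝ)) (fun x => f x * pk (t + e * I) x) t
  have h2 := Measure.integral_comp_mul_left (fun x => f (t + x) * pk (t + e * I) (t + x)) e
  rw [h1, abs_of_pos (by positivity), smul_eq_mul] at h2
  have h3 : ∫ x, f x * pk (t + e * I) x =
      e * ∫ x, f (t + e * x) * pk (t + e * I) (t + e * x) := by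
    rw [h2]; field_simp
  rw [h3, ← integral_const_mul]
  congr 1; ext s
  simp [pk]
  have : (e * s) ^ 2 + e ^ 2 ≠ 0 := by positivity
  field_simp
  ring

lemma stieltjes (ρ : Measure ℝ) [IsProbabilityMeasure ρ] (f : BoundedContinuousFunction ℝ ℝ) :
    Tendsto (fun e : ℝ => ∫ x : ℝ, f x * ∫ t, pk (x + e * I) t ∂ρ) (𝓝[>] 0)
      (𝓝 (Real.pi * ∫ t, f t ∂ρ)) := by
  have hswap : ∀ e : ℝ, 0 < e → ∫ x : ℝ, f x * ∫ t, pk (x + e * I) t ∂ρ =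
      ∫ t, (∫ s, f (t + e * s) * (1 + s ^ 2)⁻¹) ∂ρ := by
    intro e he
    have hsym : ∀ x t : ℝ, pk (x + e * I) t = pk (t + e * I) x := by
      intro x t; simp [pk]; ring
    have hp : ∀ t : ℝ, 0 < ((t : ℂ) + e * I).im := by intro t; simpa using he
    have hin : ∀ x : ℝ, f x * ∫ t, pk (x + e * I) t ∂ρ = ∫ t : ℝ, f x * pk (t + e * I) x ∂ρ := by
      intro x
      rw [integral_const_mul]
      congr 2; ext t; exact hsym x t
    simp_rw [hin]
    rw [integral_integral_swap]
    · simp_rw [inner_int f _ e he]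
    · have hc : Continuous (fun q : ℝ × ℝ => pk (q.2 + e * I) q.1) := by
        simp only [pk]
        refine Continuous.div (by fun_prop) (by fun_prop) fun q => ?_
        simp; positivity
      have hi : Integrable (fun q : ℝ × ℝ => pk (q.2 + e * I) q.1) (volume.prod ρ) := by
        rw [integrable_prod_iff' hc.aestronglyMeasurable]
        refine ⟨Eventually.of_forall fun t => pk_integrable (hp t), ?_⟩
        have : (fun t : ℝ => ∫ x : ℝ, ‖pk (t + e * I) x‖) = fun _ => Real.pi := by
          ext t
          simp_rw [Real.norm_of_nonneg (pk_pos (hp t) _).le]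
          exact pk_integral (hp t)
        simp only [this]
        exact integrable_const _
      refine Integrable.bdd_mul (c := ‖f‖) hi ?_ (Eventually.of_forall fun q => f.norm_coe_le_norm _)
      exact (f.continuous.comp continuous_fst).aestronglyMeasurable
  have hlim : Tendsto (fun e : ℝ => ∫ t, (∫ s, f (t + e * s) * (1 + s ^ 2)⁻¹) ∂ρ) (𝓝[>] 0)
      (𝓝 (∫ t, f t * Real.pi ∂ρ)) := by
    have hbd : ∀ e t s : ℝ, ‖f (t + e * s) * (1 + s ^ 2)⁻¹‖ ≤ ‖f‖ * (1 + s ^ 2)⁻¹ := by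
      intro e t s
      rw [norm_mul, Real.norm_of_nonneg (by positivity : 0 ≤ (1 + s ^ 2)⁻¹)]
      gcongr
      exact f.norm_coe_le_norm _
    have hbi : Integrable (fun s : ℝ => ‖f‖ * (1 + s ^ 2)⁻¹) :=
      integrable_inv_one_add_sq.const_mul _
    have hc1 : ∀ s : ℝ, (1 + s ^ 2) ≠ 0 := fun s => by positivity
    have hcs : ∀ e t : ℝ, Continuous fun s : ℝ => f (t + e * s) * (1 + s ^ 2)⁻¹ := by
      intro e t
      exact (f.continuous.comp (by fun_prop)).mul (Continuous.inv₀ (by fun_prop) hc1)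
    have hct : ∀ e s : ℝ, Continuous fun t : ℝ => f (t + e * s) * (1 + s ^ 2)⁻¹ := by
      intro e s
      exact (f.continuous.comp (by fun_prop)).mul continuous_const
    refine tendsto_integral_filter_of_dominated_convergence (fun _ => ‖f‖ * Real.pi) ?_ ?_
      (integrable_const _) ?_
    · refine Eventually.of_forall fun e => Continuous.aestronglyMeasurable ?_
      refine continuous_of_dominated (fun t => (hcs e t).aestronglyMeasurable)
        (fun t => Eventually.of_forall (hbd e t)) hbi (Eventually.of_forall (hct e))
    · refine Eventually.of_forall fun e => Eventually.of_forall fun t => ?_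
      refine (norm_integral_le_of_norm_le hbi (Eventually.of_forall (hbd e t))).trans ?_
      rw [integral_const_mul, integral_univ_inv_one_add_sq]
    · refine Eventually.of_forall fun t => ?_
      rw [← integral_univ_inv_one_add_sq, ← integral_const_mul]
      refine tendsto_integral_filter_of_dominated_convergence _
        (Eventually.of_forall fun e => (hcs e t).aestronglyMeasurable)
        (Eventually.of_forall fun e => Eventually.of_forall (hbd e t)) hbi
        (Eventually.of_forall fun s => ?_)
      have hce : Continuous fun e : ℝ => f (t + e * s) * (1 + s ^ 2)⁻¹ :=
        (f.continuous.comp (by fun_prop)).mul continuous_const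
      have := hce.tendsto 0
      simp only [zero_mul, add_zero] at this
      exact this.mono_left nhdsWithin_le_nhds
  rw [integral_mul_const, mul_comm] at hlim
  refine hlim.congr' ?_
  filter_upwards [self_mem_nhdsWithin] with e he
  exact (hswap e he).symm

lemma cauchy_inj (ρ σ : Measure ℝ) [IsProbabilityMeasure ρ] [IsProbabilityMeasure σ]
    (h : ∀ z : ℂ, 0 < z.im → cauchy ρ z = cauchy σ z) : ρ = σ := by
  apply ext_of_forall_integral_eq_of_IsFiniteMeasure
  intro f
  have h1 := stieltjes ρ f
  have h2 := stieltjes σ f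
  have h3 : Real.pi * ∫ t, f t ∂ρ = Real.pi * ∫ t, f t ∂σ := by
    refine tendsto_nhds_unique h1 (h2.congr' ?_)
    filter_upwards [self_mem_nhdsWithin] with e he
    congr 1; ext x
    have hz : 0 < ((x : ℂ) + e * I).im := by simpa using he
    have := congrArg Complex.im (h _ hz)
    rw [cauchy_im ρ hz, cauchy_im σ hz, neg_inj] at this
    rw [this]
  exact mul_left_cancel₀ Real.pi_ne_zero h3

/-- For probability measures μ, ν on ℝ there is a unique probability
measure ρ (the geometric mean μ♭ν) with G_ρ(z)² = G_μ(z)·G_ν(z) on ℂ₊. -/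
theorem geometric_mean_exists_unique (μ ν : Measure ℝ)
    [IsProbabilityMeasure μ] [IsProbabilityMeasure ν] :
    ∃! ρ : Measure ℝ, IsProbabilityMeasure ρ ∧
      ∀ z : ℂ, 0 < z.im → (cauchy ρ z) ^ 2 = cauchy μ z * cauchy ν z := by
  obtain ⟨ρ, hρ, h⟩ := exists_root μ ν
  refine ⟨ρ, ⟨hρ, h⟩, ?_⟩
  rintro σ ⟨hσ, h'⟩
  refine cauchy_inj σ ρ fun z hz => ?_
  have e := (h' z hz).trans (h z hz).symm
  rcases sq_eq_sq_iff_eq_or_eq_neg.mp e with e | e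
  · exact e
  · exfalso
    have a := cauchy_im_neg σ hz
    have b := cauchy_im_neg ρ hz
    rw [e] at a
    simp at a
    linarith
end

section
/- Let μ_n, ν_n, μ, ν be probability measures on ℝ with μ_n ⇀ μ and ν_n ⇀ ν weakly, and let ρ_n and ρ be the probability measures satisfying G_{ρ_n}(z)² = G_{μ_n}(z)·G_{ν_n}(z) and G_ρ(z)² = G_μ(z)·G_ν(z) for all z ∈ ℂ₊. Then ρ_n ⇀ ρ weakly. -/
open MeasureTheory Complex Filter Topology

open scoped BoundedContinuousFunction

lemma gm_ne {z : ℂ} (hz : z.im ≠ 0) (t : ℝ) : z - (t : ℂ) ≠ 0 := by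
  intro h
  apply hz
  have := congrArg Complex.im h
  simpa using this

lemma gm_bound {z : ℂ} (hz : z.im ≠ 0) (t : ℝ) : ‖(z - (t : ℂ))⁻¹‖ ≤ |z.im|⁻¹ := by
  rw [norm_inv]
  have h : |z.im| ≤ ‖z - (t : ℂ)‖ := by
    have := Complex.abs_im_le_norm (z - (t : ℂ))
    simpa using this
  have h0 : 0 < |z.im| := abs_pos.mpr hz
  gcongr

/-- resolvent as a bounded continuous function -/
noncomputable def gmR (z : {z : ℂ // z.im ≠ 0}) : ℝ →ᵇ ℂ :=
  BoundedContinuousFunction.ofNormedAddCommGroup (fun t : ℝ => (z.1 - (t : ℂ))⁻¹)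
    (Continuous.inv₀ (by fun_prop) (gm_ne z.2)) (|z.1.im|⁻¹) (gm_bound z.2)

lemma gmR_apply (z : {z : ℂ // z.im ≠ 0}) (t : ℝ) : gmR z t = (z.1 - (t : ℂ))⁻¹ := rfl

lemma gmR_norm (z : {z : ℂ // z.im ≠ 0}) : ‖gmR z‖ ≤ |z.1.im|⁻¹ :=
  BoundedContinuousFunction.norm_ofNormedAddCommGroup_le _ (by positivity) _

lemma gmR_sub (z w : {z : ℂ // z.im ≠ 0}) : gmR w - gmR z = (z.1 - w.1) • (gmR z * gmR w) := by
  ext t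
  have h1 := gm_ne z.2 t
  have h2 := gm_ne w.2 t
  simp only [BoundedContinuousFunction.coe_sub, Pi.sub_apply, gmR_apply,
    BoundedContinuousFunction.coe_smul, BoundedContinuousFunction.coe_mul, Pi.mul_apply,
    smul_eq_mul]
  field_simp
  ring

lemma gmR_star (z : {z : ℂ // z.im ≠ 0}) :
    star (gmR z) = gmR ⟨(starRingEnd ℂ) z.1, by simpa using z.2⟩ := by
  ext t
  simp [gmR_apply]

/-- span of resolvents and 1 -/
noncomputable def gmS : Submodule ℂ (ℝ →ᵇ ℂ) := Submodule.span ℂ (insert 1 (Set.range gmR))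

noncomputable def gmW : Submodule ℂ (ℝ →ᵇ ℂ) := gmS.topologicalClosure

lemma gmW_closed : IsClosed (gmW : Set (ℝ →ᵇ ℂ)) := Submodule.isClosed_topologicalClosure _

lemma gmS_le : gmS ≤ gmW := Submodule.le_topologicalClosure _

lemma gmW_one : (1 : ℝ →ᵇ ℂ) ∈ gmW := gmS_le (Submodule.subset_span (by simp))

lemma gmW_R (z) : gmR z ∈ gmW := gmS_le (Submodule.subset_span (by simp))

/-- induction principle: a closed submodule containing generators contains W -/
lemma gmW_le (V : Submodule ℂ (ℝ →ᵇ ℂ)) (hc : IsClosed (V : Set (ℝ →ᵇ ℂ)))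
    (h1 : (1 : ℝ →ᵇ ℂ) ∈ V) (hR : ∀ z, gmR z ∈ V) : gmW ≤ V := by
  apply Submodule.topologicalClosure_minimal _ _ hc
  apply Submodule.span_le.mpr
  rintro g (rfl | ⟨z, rfl⟩)
  · exact h1
  · exact hR z

lemma gmW_RR_ne (z w : {z : ℂ // z.im ≠ 0}) (h : z.1 ≠ w.1) : gmR z * gmR w ∈ gmW := by
  have h' : z.1 - w.1 ≠ 0 := sub_ne_zero.mpr h
  have : gmR z * gmR w = (z.1 - w.1)⁻¹ • (gmR w - gmR z) := by
    rw [gmR_sub, smul_smul, inv_mul_cancel₀ h', one_smul]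
  rw [this]
  exact gmW.smul_mem _ (gmW.sub_mem (gmW_R w) (gmW_R z))

lemma gmW_sq (z : {z : ℂ // z.im ≠ 0}) : gmR z * gmR z ∈ gmW := by
  have him (n : ℕ) : (z.1 + ((z.1.im / (n + 1) : ℝ) : ℂ) * I).im = z.1.im * (1 + 1 / (n + 1)) := by
    rw [Complex.add_im, Complex.im_ofReal_mul, Complex.I_im]
    ring
  have hpos (n : ℕ) : (1 : ℝ) ≤ 1 + 1 / ((n : ℝ) + 1) := by
    have : (0 : ℝ) ≤ 1 / ((n : ℝ) + 1) := by positivity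
    linarith
  let w : ℕ → {z : ℂ // z.im ≠ 0} := fun n =>
    ⟨z.1 + ((z.1.im / (n + 1) : ℝ) : ℂ) * I, by
      rw [him]
      exact mul_ne_zero z.2 (by linarith [hpos n])⟩
  have hz0 : 0 < |z.1.im| := abs_pos.mpr z.2
  have hw : Tendsto (fun n => gmR (w n)) atTop (𝓝 (gmR z)) := by
    rw [tendsto_iff_norm_sub_tendsto_zero]
    have hlim : Tendsto (fun n : ℕ => |z.1.im|⁻¹ * (1 / ((n : ℝ) + 1))) atTop (𝓝 0) := by
      simpa using (tendsto_one_div_add_atTop_nhds_zero_nat (𝕜 := ℝ)).const_mul (|z.1.im|⁻¹)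
    refine squeeze_zero (fun _ => norm_nonneg _) (fun n => ?_) hlim
    rw [gmR_sub, norm_smul]
    have e1 : ‖z.1 - (w n).1‖ = |z.1.im| * (1 / ((n : ℝ) + 1)) := by
      simp only [w, sub_add_cancel_left, norm_neg, norm_mul, Complex.norm_I, mul_one,
        Complex.norm_real, Real.norm_eq_abs, abs_div]
      rw [abs_of_pos (by positivity : (0 : ℝ) < (n : ℝ) + 1)]
      ring
    have e2 : ‖gmR (w n)‖ ≤ |z.1.im|⁻¹ := by
      refine (gmR_norm _).trans ?_
      have : |z.1.im| ≤ |(w n).1.im| := by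
        simp only [w]
        rw [him, abs_mul, abs_of_nonneg (by linarith [hpos n] : (0 : ℝ) ≤ 1 + 1 / ((n : ℝ) + 1))]
        nlinarith [hpos n]
      gcongr
    have e3 := gmR_norm z
    rw [e1]
    calc |z.1.im| * (1 / ((n : ℝ) + 1)) * ‖gmR z * gmR (w n)‖
        ≤ |z.1.im| * (1 / ((n : ℝ) + 1)) * (|z.1.im|⁻¹ * |z.1.im|⁻¹) := by
          gcongr
          refine (norm_mul_le _ _).trans ?_
          gcongr
      _ = _ := by field_simp
  refine gmW_closed.mem_of_tendsto (hw.const_mul (gmR z)) (Eventually.of_forall fun n => ?_)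
  apply gmW_RR_ne
  intro h
  have : ((z.1.im / (n + 1) : ℝ) : ℂ) * I = 0 := by
    simpa [w] using h
  have h3 : (n : ℝ) + 1 ≠ 0 := by positivity
  rcases mul_eq_zero.mp this with h | h
  · exact div_ne_zero z.2 h3 (by exact_mod_cast h)
  · exact I_ne_zero h

lemma gmW_RR (z w : {z : ℂ // z.im ≠ 0}) : gmR z * gmR w ∈ gmW := by
  by_cases h : z.1 = w.1
  · have : z = w := Subtype.ext h
    rw [this]
    exact gmW_sq w
  · exact gmW_RR_ne z w h

lemma gmW_R_mul (z) {g : ℝ →ᵇ ℂ} (hg : g ∈ gmW) : gmR z * g ∈ gmW := by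
  let V : Submodule ℂ (ℝ →ᵇ ℂ) := gmW.comap (LinearMap.mulLeft ℂ (gmR z))
  have hV : gmW ≤ V := by
    apply gmW_le
    · exact gmW_closed.preimage (continuous_const.mul continuous_id)
    · simpa [V] using gmW_R z
    · intro w
      simpa [V] using gmW_RR z w
  exact hV hg

lemma gmW_star {g : ℝ →ᵇ ℂ} (hg : g ∈ gmW) : star g ∈ gmW := by
  let V : Submodule ℂ (ℝ →ᵇ ℂ) :=
    { carrier := {g | star g ∈ gmW}
      add_mem' := fun {a b} ha hb => by
        simp only [Set.mem_ofPred_eq, star_add] at *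
        exact gmW.add_mem ha hb
      zero_mem' := by simp
      smul_mem' := fun c a ha => by
        simp only [Set.mem_ofPred_eq, star_smul] at *
        exact gmW.smul_mem _ ha }
  have hV : gmW ≤ V := by
    apply gmW_le
    · exact gmW_closed.preimage continuous_star
    · change star (1 : ℝ →ᵇ ℂ) ∈ gmW
      rw [star_one]
      exact gmW_one
    · intro w
      change star (gmR w) ∈ gmW
      rw [gmR_star]
      exact gmW_R _
  exact hV hg

/-- multiplier algebra of W -/
noncomputable def gmA : StarSubalgebra ℂ (ℝ →ᵇ ℂ) where
  carrier := {g | ∀ h ∈ gmW, g * h ∈ gmW}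
  mul_mem' := fun {a b} ha hb h hh => by
    rw [mul_assoc]
    exact ha _ (hb _ hh)
  add_mem' := fun {a b} ha hb h hh => by
    rw [add_mul]
    exact gmW.add_mem (ha _ hh) (hb _ hh)
  algebraMap_mem' := fun c h hh => by
    rw [← Algebra.smul_def]
    exact gmW.smul_mem _ hh
  star_mem' := fun {a} ha h hh => by
    have := gmW_star (ha _ (gmW_star hh))
    rwa [star_mul, star_star, mul_comm] at this

lemma gmA_sub {g : ℝ →ᵇ ℂ} (hg : g ∈ gmA) : g ∈ gmW := by
  have := hg 1 gmW_one
  rwa [mul_one] at this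

lemma gmA_sep : (gmA.map (BoundedContinuousFunction.toContinuousMapStarₐ ℂ)).SeparatesPoints := by
  intro x y hxy
  let z : {z : ℂ // z.im ≠ 0} := ⟨I, by simp⟩
  refine ⟨gmR z, ⟨_, ⟨gmR z, fun h hh => gmW_R_mul z hh, rfl⟩, rfl⟩, ?_⟩
  intro h
  apply hxy
  have h' : (I - (x : ℂ))⁻¹ = (I - (y : ℂ))⁻¹ := h
  have := inv_injective h'
  simpa using this

/-- functionals converging on generators converge on W -/
lemma gmW_tendsto (ρn : ℕ → Measure ℝ) (ρ : Measure ℝ) [∀ n, IsProbabilityMeasure (ρn n)]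
    [IsProbabilityMeasure ρ]
    (h : ∀ z : ℂ, 0 < z.im → Tendsto (fun n => cauchy (ρn n) z) atTop (𝓝 (cauchy ρ z)))
    {g : ℝ →ᵇ ℂ} (hg : g ∈ gmW) :
    Tendsto (fun n => ∫ x, g x ∂(ρn n)) atTop (𝓝 (∫ x, g x ∂ρ)) := by
  let V : Submodule ℂ (ℝ →ᵇ ℂ) :=
    { carrier := {g | Tendsto (fun n => ∫ x, g x ∂(ρn n)) atTop (𝓝 (∫ x, g x ∂ρ))}
      add_mem' := fun {a b} ha hb => by
        simp only [Set.mem_ofPred_eq] at *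
        have := ha.add hb
        simp only [BoundedContinuousFunction.coe_add, Pi.add_apply]
        rw [integral_add (a.integrable ρ) (b.integrable ρ)]
        refine this.congr fun n => ?_
        rw [integral_add (a.integrable _) (b.integrable _)]
      zero_mem' := by simp
      smul_mem' := fun c a ha => by
        simp only [Set.mem_ofPred_eq] at *
        have := ha.const_mul c
        simpa only [BoundedContinuousFunction.coe_smul, smul_eq_mul, integral_const_mul] using this }
  have key (m : Measure ℝ) [IsProbabilityMeasure m] (a b : ℝ →ᵇ ℂ) :
      dist (∫ x, a x ∂m) (∫ x, b x ∂m) ≤ dist a b := by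
    rw [dist_eq_norm, ← integral_sub (a.integrable m) (b.integrable m), dist_eq_norm]
    simpa using (a - b).norm_integral_le_norm (μ := m)
  have hV : gmW ≤ V := by
    apply gmW_le
    · apply isClosed_of_closure_subset
      intro a ha
      change Tendsto _ _ _
      rw [Metric.tendsto_atTop]
      intro ε hε
      obtain ⟨b, hb, hab⟩ := Metric.mem_closure_iff.mp ha (ε / 3) (by positivity)
      obtain ⟨N, hN⟩ := Metric.tendsto_atTop.mp hb (ε / 3) (by positivity)
      refine ⟨N, fun n hn => ?_⟩
      have h1 := key (ρn n) a b
      have h2 := key ρ b a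
      have h3 := hN n hn
      rw [dist_comm b a] at h2
      calc _ ≤ _ := dist_triangle4 _ (∫ x, b x ∂(ρn n)) (∫ x, b x ∂ρ) _
        _ < ε := by linarith
    · change Tendsto _ _ _
      simp
    · intro w
      change Tendsto _ _ _
      simp only [gmR_apply]
      rcases lt_or_gt_of_ne w.2 with hw | hw
      · have := (Complex.continuous_conj.tendsto _).comp
          (h ((starRingEnd ℂ) w.1) (by simpa using hw))
        have e (m : Measure ℝ) : (starRingEnd ℂ) (cauchy m ((starRingEnd ℂ) w.1)) =
            ∫ x, (w.1 - (x : ℂ))⁻¹ ∂m := by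
          rw [cauchy, ← integral_conj]
          simp
        rw [e] at this
        exact this.congr fun n => e _
      · exact h w.1 hw
  exact hV hg

lemma gm_im (m : Measure ℝ) [IsProbabilityMeasure m] {z : ℂ} (hz : 0 < z.im) :
    (cauchy m z).im = ∫ t : ℝ, ((z - (t : ℂ))⁻¹).im ∂m := by
  have := (gmR ⟨z, hz.ne'⟩).integrable m
  have h2 := Complex.imCLM.integral_comp_comm this
  simpa [cauchy, gmR_apply] using h2.symm

lemma gm_im_integrable (m : Measure ℝ) [IsProbabilityMeasure m] {z : ℂ} (hz : 0 < z.im) :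
    Integrable (fun t : ℝ => ((z - (t : ℂ))⁻¹).im) m :=
  Complex.imCLM.integrable_comp ((gmR ⟨z, hz.ne'⟩).integrable m)

lemma gm_im_neg (m : Measure ℝ) [IsProbabilityMeasure m] {z : ℂ} (hz : 0 < z.im) :
    (cauchy m z).im < 0 := by
  have hlt (t : ℝ) : 0 < -((z - (t : ℂ))⁻¹).im := by
    rw [Complex.inv_im]
    have : 0 < Complex.normSq (z - (t : ℂ)) := Complex.normSq_pos.mpr (gm_ne hz.ne' t)
    simp only [sub_im, ofReal_im, sub_zero, neg_div, neg_neg]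
    positivity
  have h : 0 < ∫ t : ℝ, -((z - (t : ℂ))⁻¹).im ∂m := by
    rw [integral_pos_iff_support_of_nonneg (fun t => (hlt t).le) (gm_im_integrable m hz).neg]
    have : Function.support (fun t : ℝ => -((z - (t : ℂ))⁻¹).im) = Set.univ := by
      ext t
      simpa using (hlt t).ne'
    rw [this]
    simp
  rw [integral_neg, ← gm_im m hz] at h
  linarith

lemma gm_tail (m : Measure ℝ) [IsProbabilityMeasure m] {y : ℝ} (hy : 0 < y) :
    m {x | y < ‖x‖} ≤ ENNReal.ofReal (2 * (1 + y * (cauchy m (y * I)).im)) := by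
  have hz : 0 < ((y : ℂ) * I).im := by simpa using hy
  have hint := gm_im_integrable m hz
  have e (t : ℝ) : (((y : ℂ) * I - (t : ℂ))⁻¹).im = - (y / (y ^ 2 + t ^ 2)) := by
    rw [Complex.inv_im]
    simp [Complex.normSq_apply]
    ring
  have hI : 2 * (1 + y * (cauchy m (y * I)).im) =
      ∫ t : ℝ, 2 * (1 + y * (((y : ℂ) * I - (t : ℂ))⁻¹).im) ∂m := by
    rw [integral_const_mul, integral_add (integrable_const _) (hint.const_mul y),
      integral_const_mul, gm_im m hz]
    simp
  rw [hI]
  have hint2 : Integrable (fun t : ℝ => 2 * (1 + y * (((y : ℂ) * I - (t : ℂ))⁻¹).im)) m :=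
    ((integrable_const _).add (hint.const_mul y)).const_mul 2
  have e2 (t : ℝ) : 2 * (1 + y * (((y : ℂ) * I - (t : ℂ))⁻¹).im) = 2 * t ^ 2 / (y ^ 2 + t ^ 2) := by
    rw [e]
    have : y ^ 2 + t ^ 2 ≠ 0 := by positivity
    field_simp
    ring
  have hmeas : MeasurableSet {x : ℝ | y < ‖x‖} := measurableSet_lt measurable_const measurable_norm
  rw [ofReal_integral_eq_lintegral_ofReal hint2
    (Eventually.of_forall fun t => by
      change (0 : ℝ) ≤ 2 * (1 + y * (((y : ℂ) * I - (t : ℂ))⁻¹).im)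
      rw [e2]; positivity)]
  rw [← lintegral_indicator_one hmeas]
  apply lintegral_mono
  intro t
  by_cases ht : y < ‖t‖
  · rw [Set.indicator_of_mem (by exact ht)]
    simp only [Pi.one_apply]
    rw [e2, ← ENNReal.ofReal_one]
    apply ENNReal.ofReal_le_ofReal
    rw [le_div_iff₀ (by positivity)]
    have : y ^ 2 ≤ t ^ 2 := by
      rw [← sq_abs t]
      rw [Real.norm_eq_abs] at ht
      gcongr
    linarith
  · rw [Set.indicator_of_notMem (by exact ht)]
    exact zero_le

lemma gm_lim (m : Measure ℝ) [IsProbabilityMeasure m] :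
    Tendsto (fun y : ℝ => 2 * (1 + y * (cauchy m (y * I)).im)) atTop (𝓝 0) := by
  have e (y t : ℝ) : y * (((y : ℂ) * I - (t : ℂ))⁻¹).im = - (y ^ 2 / (y ^ 2 + t ^ 2)) := by
    rw [Complex.inv_im]
    simp [Complex.normSq_apply]
    ring
  have h : Tendsto (fun y : ℝ => ∫ t : ℝ, - (y ^ 2 / (y ^ 2 + t ^ 2)) ∂m) atTop
      (𝓝 (∫ t : ℝ, (-1 : ℝ) ∂m)) := by
    refine tendsto_integral_filter_of_dominated_convergence (fun _ => 1) ?_ ?_ (by simp) ?_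
    · refine Eventually.of_forall fun y => Measurable.aestronglyMeasurable ?_
      fun_prop
    · refine Eventually.of_forall fun y => Eventually.of_forall fun t => ?_
      rw [norm_neg, Real.norm_of_nonneg (by positivity)]
      apply div_le_one_of_le₀ <;> nlinarith [sq_nonneg y, sq_nonneg t]
    · refine Eventually.of_forall fun t => Tendsto.neg ?_
      have h1 : Tendsto (fun y : ℝ => t ^ 2 / y ^ 2) atTop (𝓝 0) :=
        tendsto_const_nhds.div_atTop (tendsto_pow_atTop (by norm_num))
      have h2 : Tendsto (fun y : ℝ => (1 + t ^ 2 / y ^ 2)⁻¹) atTop (𝓝 1) := by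
        simpa using (h1.const_add 1).inv₀ (by norm_num)
      refine h2.congr' ?_
      filter_upwards [eventually_gt_atTop 0] with y hy
      field_simp
  have h3 : Tendsto (fun y : ℝ => y * (cauchy m (y * I)).im) atTop (𝓝 (-1)) := by
    simp only [integral_const, probReal_univ, one_smul] at h
    refine h.congr' ?_
    filter_upwards [eventually_gt_atTop 0] with y hy
    rw [gm_im m (by simpa using hy), ← integral_const_mul]
    simp only [e]
  simpa using (h3.const_add 1).const_mul 2

lemma gm_tight (ρn : ℕ → Measure ℝ) (ρ : Measure ℝ) [∀ n, IsProbabilityMeasure (ρn n)]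
    [IsProbabilityMeasure ρ]
    (h : ∀ z : ℂ, 0 < z.im → Tendsto (fun n => cauchy (ρn n) z) atTop (𝓝 (cauchy ρ z))) :
    IsTightMeasureSet (Set.range ρn) := by
  apply isTightMeasureSet_range_of_tendsto_limsup_measure_norm_gt
  have hl : Tendsto (fun y : ℝ => ENNReal.ofReal (2 * (1 + y * (cauchy ρ (y * I)).im))) atTop
      (𝓝 0) := by
    simpa using ENNReal.tendsto_ofReal (gm_lim ρ)
  refine tendsto_of_tendsto_of_tendsto_of_le_of_le' tendsto_const_nhds hl
    (Eventually.of_forall fun _ => zero_le) ?_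
  filter_upwards [eventually_gt_atTop 0] with y hy
  have h1 := h (y * I) (by simpa using hy)
  have h2 : Tendsto (fun n => ENNReal.ofReal (2 * (1 + y * (cauchy (ρn n) (y * I)).im))) atTop
      (𝓝 (ENNReal.ofReal (2 * (1 + y * (cauchy ρ (y * I)).im)))) := by
    apply ENNReal.tendsto_ofReal
    exact ((((Complex.continuous_im.tendsto _).comp h1).const_mul y).const_add 1).const_mul 2
  rw [← h2.limsup_eq]
  exact limsup_le_limsup (Eventually.of_forall fun n => gm_tail (ρn n) hy)

lemma gm_weak_cauchy (μn : ℕ → Measure ℝ) (μ : Measure ℝ) [∀ n, IsProbabilityMeasure (μn n)]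
    [IsProbabilityMeasure μ]
    (hμ : ∀ f : BoundedContinuousFunction ℝ ℝ,
      Tendsto (fun n => ∫ x, f x ∂(μn n)) atTop (𝓝 (∫ x, f x ∂μ)))
    (z : ℂ) (hz : 0 < z.im) : Tendsto (fun n => cauchy (μn n) z) atTop (𝓝 (cauchy μ z)) := by
  let P : ℕ → ProbabilityMeasure ℝ := fun n => ⟨μn n, inferInstance⟩
  let Q : ProbabilityMeasure ℝ := ⟨μ, inferInstance⟩
  have h : Tendsto P atTop (𝓝 Q) := ProbabilityMeasure.tendsto_iff_forall_integral_tendsto.mpr hμ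
  exact (ProbabilityMeasure.tendsto_iff_forall_integral_rclike_tendsto ℂ).mp h (gmR ⟨z, hz.ne'⟩)

/-- weak continuity of the geometric mean transform. -/
theorem geometric_mean_weak_continuous
    (μn νn ρn : ℕ → Measure ℝ) (μ ν ρ : Measure ℝ)
    [∀ n, IsProbabilityMeasure (μn n)] [∀ n, IsProbabilityMeasure (νn n)]
    [∀ n, IsProbabilityMeasure (ρn n)]
    [IsProbabilityMeasure μ] [IsProbabilityMeasure ν] [IsProbabilityMeasure ρ]
    (hμ : ∀ f : BoundedContinuousFunction ℝ ℝ,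
      Tendsto (fun n => ∫ x, f x ∂(μn n)) atTop (𝓝 (∫ x, f x ∂μ)))
    (hν : ∀ f : BoundedContinuousFunction ℝ ℝ,
      Tendsto (fun n => ∫ x, f x ∂(νn n)) atTop (𝓝 (∫ x, f x ∂ν)))
    (hρn : ∀ n, ∀ z : ℂ, 0 < z.im →
      (cauchy (ρn n) z) ^ 2 = cauchy (μn n) z * cauchy (νn n) z)
    (hρ : ∀ z : ℂ, 0 < z.im → (cauchy ρ z) ^ 2 = cauchy μ z * cauchy ν z) :
    ∀ f : BoundedContinuousFunction ℝ ℝ,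
      Tendsto (fun n => ∫ x, f x ∂(ρn n)) atTop (𝓝 (∫ x, f x ∂ρ)) := by
  have hG : ∀ z : ℂ, 0 < z.im → Tendsto (fun n => cauchy (ρn n) z) atTop (𝓝 (cauchy ρ z)) := by
    intro z hz
    have hsq : Tendsto (fun n => (cauchy (ρn n) z) ^ 2) atTop (𝓝 ((cauchy ρ z) ^ 2)) := by
      rw [hρ z hz]
      simp only [hρn _ z hz]
      exact (gm_weak_cauchy μn μ hμ z hz).mul (gm_weak_cauchy νn ν hν z hz)
    have hneg := gm_im_neg ρ hz
    rw [tendsto_iff_norm_sub_tendsto_zero] at hsq ⊢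
    have hlim := hsq.div_const (-(cauchy ρ z).im)
    rw [zero_div] at hlim
    refine squeeze_zero (fun _ => norm_nonneg _) (fun n => ?_) hlim
    have hn := gm_im_neg (ρn n) hz
    rw [le_div_iff₀ (by linarith), sq_sub_sq, norm_mul, mul_comm]
    gcongr
    have := Complex.abs_im_le_norm (cauchy (ρn n) z + cauchy ρ z)
    rw [Complex.add_im] at this
    linarith [neg_le_abs ((cauchy (ρn n) z).im + (cauchy ρ z).im)]
  let P : ℕ → ProbabilityMeasure ℝ := fun n => ⟨ρn n, inferInstance⟩
  let Q : ProbabilityMeasure ℝ := ⟨ρ, inferInstance⟩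
  have h : Tendsto P atTop (𝓝 Q) := by
    refine ProbabilityMeasure.tendsto_of_tight_of_separatesPoints ℂ (A := gmA) ?_ gmA_sep ?_
    · exact gm_tight ρn ρ hG
    · intro g hg
      exact gmW_tendsto ρn ρ hG (gmA_sub hg)
  exact ProbabilityMeasure.tendsto_iff_forall_integral_tendsto.mp h
end

section
/- Let μ_n and μ be probability measures on ℝ with finite second moments such that μ_n ⇀ μ weakly and ∫ t² dμ_n(t) → ∫ t² dμ(t) ∈ (0,∞). Then the square biases converge weakly: μ_n^□ ⇀ μ^□. -/
open MeasureTheory Filter Topology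

/-- The square bias of a measure on ℝ with finite second moment: the point mass at 0
if the second moment vanishes, and otherwise the measure with density t²/m₂(μ) w.r.t. μ. -/
noncomputable def sqBias (μ : Measure ℝ) : Measure ℝ :=
  if (∫ t, t ^ 2 ∂μ) = 0 then Measure.dirac 0
  else μ.withDensity fun t => ENNReal.ofReal (t ^ 2 / ∫ s, s ^ 2 ∂μ)

theorem sqBias_integral (μ : Measure ℝ) (h : (∫ t, t ^ 2 ∂μ) ≠ 0) (f : BoundedContinuousFunction ℝ ℝ) :
    ∫ x, f x ∂(sqBias μ) = (∫ x, f x * x ^ 2 ∂μ) / ∫ t, t ^ 2 ∂μ := by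
  have h0 : 0 ≤ ∫ t, t ^ 2 ∂μ := integral_nonneg fun t => sq_nonneg t
  rw [sqBias, if_neg h, integral_withDensity_eq_integral_toReal_smul (by fun_prop) (by simp),
    ← integral_div]
  refine integral_congr_ae (Eventually.of_forall fun x => ?_)
  simp only [smul_eq_mul]
  rw [ENNReal.toReal_ofReal (by positivity)]
  ring

noncomputable def truncSq (K : ℕ) : BoundedContinuousFunction ℝ ℝ :=
  BoundedContinuousFunction.ofNormedAddCommGroup (fun t : ℝ => min (t ^ 2) (K : ℝ)) (by fun_prop) K
    (by
      intro x
      rw [Real.norm_of_nonneg (by positivity)]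
      exact min_le_right _ _)

theorem truncSq_apply (K : ℕ) (t : ℝ) : truncSq K t = min (t ^ 2) (K : ℝ) := rfl

theorem integrable_mul_sq (μ : Measure ℝ) (h2 : Integrable (fun t : ℝ => t ^ 2) μ)
    (f : BoundedContinuousFunction ℝ ℝ) : Integrable (fun t => f t * t ^ 2) μ :=
  h2.bdd_mul (c := ‖f‖) f.continuous.aestronglyMeasurable
    (Eventually.of_forall fun x => f.norm_coe_le_norm x)

theorem trunc_bound (μ : Measure ℝ) [IsProbabilityMeasure μ]
    (h2 : Integrable (fun t : ℝ => t ^ 2) μ) (f : BoundedContinuousFunction ℝ ℝ) (K : ℕ) :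
    |(∫ t, f t * t ^ 2 ∂μ) - ∫ t, (f * truncSq K) t ∂μ| ≤
      ‖f‖ * ((∫ t, t ^ 2 ∂μ) - ∫ t, truncSq K t ∂μ) := by
  have i1 : Integrable (fun t => (f * truncSq K) t) μ := (f * truncSq K).integrable μ
  have i2 : Integrable (fun t => truncSq K t) μ := (truncSq K).integrable μ
  rw [← integral_sub (integrable_mul_sq μ h2 f) i1, ← integral_sub h2 i2, ← integral_const_mul]
  rw [← Real.norm_eq_abs]
  refine norm_integral_le_of_norm_le ((h2.sub i2).const_mul _) (Eventually.of_forall fun t => ?_)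
  have hle : 0 ≤ t ^ 2 - truncSq K t := sub_nonneg.2 (min_le_left _ _)
  simp only [BoundedContinuousFunction.coe_mul, Pi.mul_apply, Pi.sub_apply]
  rw [← mul_sub, norm_mul, Real.norm_of_nonneg hle]
  exact mul_le_mul_of_nonneg_right (f.norm_coe_le_norm t) hle

theorem trunc_tendsto (μ : Measure ℝ) (h2 : Integrable (fun t : ℝ => t ^ 2) μ) :
    Tendsto (fun K : ℕ => ∫ t, truncSq K t ∂μ) atTop (𝓝 (∫ t, t ^ 2 ∂μ)) := by
  refine tendsto_integral_of_dominated_convergence (fun t => t ^ 2)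
    (fun K => (truncSq K).continuous.aestronglyMeasurable) h2
    (fun K => Eventually.of_forall fun t => ?_) (Eventually.of_forall fun t => ?_)
  · rw [truncSq_apply, Real.norm_of_nonneg (by positivity)]
    exact min_le_left _ _
  · refine tendsto_const_nhds.congr' ?_
    obtain ⟨N, hN⟩ := exists_nat_ge (t ^ 2)
    filter_upwards [eventually_ge_atTop N] with K hK
    rw [truncSq_apply, min_eq_left]
    exact hN.trans (by exact_mod_cast hK)

/-- if μₙ ⇀ μ weakly and the second moments converge to a positive finite
limit, then the square biases converge weakly: μₙ^□ ⇀ μ^□. -/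
theorem sqBias_weak_continuous (μn : ℕ → Measure ℝ) (μ : Measure ℝ)
    [∀ n, IsProbabilityMeasure (μn n)] [IsProbabilityMeasure μ]
    (hn2 : ∀ n, Integrable (fun t => t ^ 2) (μn n))
    (h2 : Integrable (fun t => t ^ 2) μ)
    (hweak : ∀ f : BoundedContinuousFunction ℝ ℝ,
      Tendsto (fun n => ∫ x, f x ∂(μn n)) atTop (𝓝 (∫ x, f x ∂μ)))
    (hmom : Tendsto (fun n => ∫ t, t ^ 2 ∂(μn n)) atTop (𝓝 (∫ t, t ^ 2 ∂μ)))
    (hpos : 0 < ∫ t, t ^ 2 ∂μ) :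
    ∀ f : BoundedContinuousFunction ℝ ℝ,
      Tendsto (fun n => ∫ x, f x ∂(sqBias (μn n))) atTop (𝓝 (∫ x, f x ∂(sqBias μ))) := by
  intro f
  have key : Tendsto (fun n => ∫ x, f x * x ^ 2 ∂(μn n)) atTop (𝓝 (∫ x, f x * x ^ 2 ∂μ)) := by
    rw [Metric.tendsto_nhds]
    intro ε hε
    have hK : Tendsto (fun K : ℕ => 2 * (‖f‖ * ((∫ t, t ^ 2 ∂μ) - ∫ t, truncSq K t ∂μ)))
        atTop (𝓝 0) := by
      have := (((trunc_tendsto μ h2).const_sub (∫ t, t ^ 2 ∂μ)).const_mul ‖f‖).const_mul 2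
      simpa using this
    obtain ⟨K, hK⟩ := (hK.eventually_lt_const hε).exists
    have hn : Tendsto (fun n => |(∫ t, (f * truncSq K) t ∂(μn n)) - ∫ t, (f * truncSq K) t ∂μ|
        + ‖f‖ * ((∫ t, t ^ 2 ∂(μn n)) - ∫ t, truncSq K t ∂(μn n))
        + ‖f‖ * ((∫ t, t ^ 2 ∂μ) - ∫ t, truncSq K t ∂μ)) atTop
        (𝓝 (|(∫ t, (f * truncSq K) t ∂μ) - ∫ t, (f * truncSq K) t ∂μ|
        + ‖f‖ * ((∫ t, t ^ 2 ∂μ) - ∫ t, truncSq K t ∂μ)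
        + ‖f‖ * ((∫ t, t ^ 2 ∂μ) - ∫ t, truncSq K t ∂μ))) :=
      ((((hweak (f * truncSq K)).sub_const _).abs).add
        ((hmom.sub (hweak (truncSq K))).const_mul _)).add_const _
    rw [sub_self, abs_zero] at hn
    filter_upwards [hn.eventually_lt_const (u := ε) (by linarith)] with n h
    refine lt_of_le_of_lt ?_ h
    have b1 := abs_le.1 (trunc_bound (μn n) (hn2 n) f K)
    have b2 := abs_le.1 (trunc_bound μ h2 f K)
    have b3 := abs_le.1 (le_refl |(∫ t, (f * truncSq K) t ∂(μn n)) - ∫ t, (f * truncSq K) t ∂μ|)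
    rw [Real.dist_eq, abs_le]
    constructor <;> linarith [b1.1, b1.2, b2.1, b2.2, b3.1, b3.2]
  have hne : ∀ᶠ n in atTop, (∫ t, t ^ 2 ∂(μn n)) ≠ 0 := hmom.eventually_ne hpos.ne'
  rw [sqBias_integral μ hpos.ne' f]
  refine (key.div hmom hpos.ne').congr' ?_
  filter_upwards [hne] with n hn
  exact (sqBias_integral (μn n) hn f).symm
end
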